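/- Let f : A → A be a covering map of degree d with |d| > 1, let K ⊆ A be an essential continuum with f(K) ⊆ K, and let F : Ã → Ã be a lift of f. Then there exists a continuous map H : π⁻¹(K) → ℝ satisfying (1) H(z + 1) = H(z) + 1, (2) H(F(z)) = d·H(z), (3) (x,y) ↦ H(x,y) − x is bounded on π⁻¹(K), and (4) H(z) = lim_{n→∞} (Fⁿ(z))₁ / dⁿ, which is moreover surjective onto ℝ. -/

import Mathlib

open Set Filter Topology

noncomputable section

/-- The open annulus `A = S¹ × (0,1)`. -/
abbrev Ann : Type := Circle × (Set.Ioo (0:ℝ) 1)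

/-- The universal cover `Ã = ℝ × (0,1)`. -/
abbrev AnnTil : Type := ℝ × (Set.Ioo (0:ℝ) 1)

/-- The covering projection `π(x,y) = (exp(2πix), y)`. -/
def pr : AnnTil → Ann := fun z => (Circle.exp (2 * Real.pi * z.1), z.2)

/-- Translation by an integer in the first coordinate: `z + k`. -/
def tr (z : AnnTil) (k : ℤ) : AnnTil := (z.1 + k, z.2)

/-- `F` is a lift of `f`. -/
def IsLift (f : Ann → Ann) (F : AnnTil → AnnTil) : Prop :=
  Continuous F ∧ pr ∘ F = f ∘ pr

/-- `f` has degree `d`: some lift satisfies `F(z+1) = F(z) + d`. -/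
def HasDegree (f : Ann → Ann) (d : ℤ) : Prop :=
  ∃ F : AnnTil → AnnTil, IsLift f F ∧ ∀ z, F (tr z 1) = tr (F z) d

/-- A subset of the annulus is essential if it is not contained in any
connected, simply connected open subset. -/
def IsEssential (K : Set Ann) : Prop :=
  ¬ ∃ U : Set Ann, IsOpen U ∧ IsConnected U ∧ SimplyConnectedSpace U ∧ K ⊆ U

/-- Nielsen equivalence of fixed points `p`, `q` of `g`: there is a path `γ`
from `p` to `q` homotopic (rel endpoints) to `g ∘ γ`. -/
def NielsenEquiv (g : Ann → Ann) (p q : Ann) : Prop :=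
  ∃ (hg : Continuous g) (hp : g p = p) (hq : g q = q) (γ : Path p q),
    γ.Homotopic ((γ.map hg).cast hp.symm hq.symm)

/-- `g` has exactly `N` Nielsen classes of fixed points. -/
def HasExactlyNielsenClasses (g : Ann → Ann) (N : ℕ) : Prop :=
  ∃ S : Finset Ann, S.card = N ∧ (∀ p ∈ S, g p = p) ∧
    (∀ p ∈ S, ∀ q ∈ S, p ≠ q → ¬ NielsenEquiv g p q) ∧
    (∀ p, g p = p → ∃ q ∈ S, NielsenEquiv g p q)

/-- `Fill K`: the union of `K` with the connected components of its
complement whose closure is compact. -/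
def Fill (K : Set Ann) : Set Ann :=
  K ∪ {x | x ∈ Kᶜ ∧ IsCompact (closure (connectedComponentIn Kᶜ x))}

/-! ### Part 1: combinatorics of the triangular lattice -/

/-- adjacency (or equality) in the triangular lattice -/
def hadj (p q : ℤ × ℤ) : Prop :=
  p.1 - q.1 ≤ 1 ∧ q.1 - p.1 ≤ 1 ∧ p.2 - q.2 ≤ 1 ∧ q.2 - p.2 ≤ 1 ∧
    (p.1 - p.2) - (q.1 - q.2) ≤ 1 ∧ (q.1 - q.2) - (p.1 - p.2) ≤ 1

lemma hadj_symm {p q : ℤ × ℤ} (h : hadj p q) : hadj q p := by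
  unfold hadj at *; omega

lemma hadj_refl (p : ℤ × ℤ) : hadj p p := by
  unfold hadj; omega

/-- product of `e` along consecutive entries -/
def wp {V G : Type*} [Group G] (e : V → V → G) : List V → G
  | [] => 1
  | [_] => 1
  | a :: b :: l => e a b * wp e (b :: l)

section wp
variable {V G : Type*} [Group G] (e : V → V → G)

@[simp] lemma wp_nil : wp e [] = 1 := rfl
@[simp] lemma wp_single (a : V) : wp e [a] = 1 := rfl
@[simp] lemma wp_cons_cons (a b : V) (l : List V) : wp e (a :: b :: l) = e a b * wp e (b :: l) := rfl

lemma wp_append (xs : List V) (a : V) (ys : List V) :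
    wp e (xs ++ a :: ys) = wp e (xs ++ [a]) * wp e (a :: ys) := by
  induction xs with
  | nil => simp
  | cons x xs ih =>
    cases xs with
    | nil => simp
    | cons y xs => simp only [List.cons_append, wp_cons_cons] at ih ⊢; rw [ih, mul_assoc]
end wp

/-- signed crossing of the upward ray based at `q` (slightly to the right) by the edge `u w`. -/
def crs (q u w : ℤ × ℤ) : ℤ :=
  if u.1 = q.1 ∧ w.1 = q.1 + 1 ∧ q.2 < u.2 then 1
  else if w.1 = q.1 ∧ u.1 = q.1 + 1 ∧ q.2 < w.2 then -1 else 0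

def crsM (q u w : ℤ × ℤ) : Multiplicative ℤ := Multiplicative.ofAdd (crs q u w)

lemma wp_crsM_step_aux (q q' : ℤ × ℤ) (g : ℤ × ℤ → ℤ) (S : Set (ℤ × ℤ))
    (h : ∀ u ∈ S, ∀ w ∈ S, hadj u w → crs q u w - crs q' u w = g w - g u) (a : ℤ × ℤ) (l : List (ℤ × ℤ))
    (b : ℤ × ℤ)
    (hl : ∀ x ∈ a :: l ++ [b], x ∈ S) (hc : List.IsChain hadj (a :: l ++ [b])) :
    (wp (crsM q) (a :: l ++ [b])).toAdd - (wp (crsM q') (a :: l ++ [b])).toAdd = g b - g a := by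
  induction l generalizing a with
  | nil =>
    simp at hl hc
    simpa [crsM] using h a hl.1 b hl.2 hc
  | cons c l ih =>
    simp only [List.cons_append, List.isChain_cons_cons] at hc ih hl ⊢
    have := ih c (fun x hx => hl x (List.mem_cons_of_mem _ hx)) hc.2
    have h2 := h a (hl a (by simp)) c (hl c (by simp)) hc.1
    simp only [wp_cons_cons, toAdd_mul, crsM, toAdd_ofAdd] at this ⊢
    omega

lemma crs_step1 (x y u1 u2 w1 w2 : ℤ) (h : hadj (u1, u2) (w1, w2))
    (_hu : u1 ≠ x ∨ u2 ≠ y) (hu' : u1 ≠ x ∨ u2 ≠ y + 1)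
    (_hw : w1 ≠ x ∨ w2 ≠ y) (hw' : w1 ≠ x ∨ w2 ≠ y + 1) :
    crs (x, y) (u1, u2) (w1, w2) - crs (x, y + 1) (u1, u2) (w1, w2) = 0 := by
  simp only [hadj, crs] at *
  split_ifs <;> omega

lemma crs_step2 (x y u1 u2 w1 w2 : ℤ) (h : hadj (u1, u2) (w1, w2))
    (_hu : u1 ≠ x ∨ u2 ≠ y) (hu' : u1 ≠ x + 1 ∨ u2 ≠ y)
    (hw : w1 ≠ x ∨ w2 ≠ y) (hw' : w1 ≠ x + 1 ∨ w2 ≠ y) :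
    crs (x, y) (u1, u2) (w1, w2) - crs (x + 1, y) (u1, u2) (w1, w2) =
     (if w1 = x + 1 ∧ y < w2 then 1 else 0) - (if u1 = x + 1 ∧ y < u2 then 1 else 0) := by
  simp only [hadj, crs] at *
  split_ifs <;> omega

lemma crs_step3 (x y u1 u2 w1 w2 : ℤ) (h : hadj (u1, u2) (w1, w2))
    (hu : u1 ≠ x ∨ u2 ≠ y) (hu' : u1 ≠ x + 1 ∨ u2 ≠ y + 1)
    (hw : w1 ≠ x ∨ w2 ≠ y) (hw' : w1 ≠ x + 1 ∨ w2 ≠ y + 1) :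
    crs (x, y) (u1, u2) (w1, w2) - crs (x + 1, y + 1) (u1, u2) (w1, w2) =
     (if w1 = x + 1 ∧ y + 1 < w2 then 1 else 0) - (if u1 = x + 1 ∧ y + 1 < u2 then 1 else 0) := by
  simp only [hadj, crs] at *
  split_ifs <;> omega

lemma crs_step (q q' : ℤ × ℤ) (S : Set (ℤ × ℤ)) (hq : q ∉ S) (hq' : q' ∉ S)
      (hcase : q' = q ∨ q' = (q.1, q.2 + 1) ∨ q' = (q.1 + 1, q.2) ∨ q' = (q.1 + 1, q.2 + 1)) :
    ∃ g : ℤ × ℤ → ℤ,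
        ∀ u ∈ S, ∀ w ∈ S, hadj u w → crs q u w - crs q' u w = g w - g u := by
  obtain ⟨x, y⟩ := q
  have ne : ∀ u : ℤ × ℤ, u ∈ S → ∀ r : ℤ × ℤ, r ∉ S → u.1 ≠ r.1 ∨ u.2 ≠ r.2 := by
    intro u hu r hr
    by_contra! hh
    exact hr (by rwa [← Prod.ext hh.1 hh.2])
  rcases hcase with rfl | rfl | rfl | rfl
  · exact ⟨0, by simp⟩
  · exact ⟨0, fun u hu w hw huw => crs_step1 x y u.1 u.2 w.1 w.2 huw (ne u hu _ hq) (ne u hu _ hq')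
      (ne w hw _ hq) (ne w hw _ hq')⟩
  · exact ⟨fun z => if z.1 = x + 1 ∧ y < z.2 then 1 else 0,
      fun u hu w hw huw => crs_step2 x y u.1 u.2 w.1 w.2 huw (ne u hu _ hq) (ne u hu _ hq')
      (ne w hw _ hq) (ne w hw _ hq')⟩
  · exact ⟨fun z => if z.1 = x + 1 ∧ y + 1 < z.2 then 1 else 0,
      fun u hu w hw huw => crs_step3 x y u.1 u.2 w.1 w.2 huw (ne u hu _ hq) (ne u hu _ hq')
      (ne w hw _ hq) (ne w hw _ hq')⟩

lemma push_case (u v w : ℤ × ℤ) (hvu : hadj v u) (hwv : hadj w v) (hwu : ¬ hadj w u)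
    (hu : u.1 ≠ v.1 ∨ u.2 ≠ v.2) (hw : w.1 ≠ v.1 ∨ w.2 ≠ v.2)
    (hu1 : u.2 < v.2 ∨ (u.2 = v.2 ∧ v.1 ≤ u.1)) (hw1 : w.2 < v.2 ∨ (w.2 = v.2 ∧ v.1 ≤ w.1)) :
    (u.1 = v.1 + 1 ∧ u.2 = v.2 ∧ w.1 = v.1 - 1 ∧ w.2 = v.2 - 1) ∨
        (w.1 = v.1 + 1 ∧ w.2 = v.2 ∧ u.1 = v.1 - 1 ∧ u.2 = v.2 - 1) := by
  unfold hadj at *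
  omega

lemma crs_push (u v w : ℤ × ℤ)
    (h : (u.1 = v.1 + 1 ∧ u.2 = v.2 ∧ w.1 = v.1 - 1 ∧ w.2 = v.2 - 1) ∨
        (w.1 = v.1 + 1 ∧ w.2 = v.2 ∧ u.1 = v.1 - 1 ∧ u.2 = v.2 - 1)) :
    crs (v.1, v.2 - 1) v u + crs (v.1, v.2 - 1) w v ≠ 0 := by
  unfold crs
  have h5 : v.1 - 1 ≠ v.1 + 1 := by omega
  rcases h with ⟨h1, h2, h3, h4⟩ | ⟨h1, h2, h3, h4⟩ <;> simp [h1, h2, h3, h4, h5]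

lemma wp_crsM_step (q q' : ℤ × ℤ) (S : Set (ℤ × ℤ)) (hq : q ∉ S) (hq' : q' ∉ S) (hqq : hadj q q')
    (a : ℤ × ℤ) (l : List (ℤ × ℤ))
    (hl : ∀ x ∈ a :: l ++ [a], x ∈ S) (hc : List.IsChain hadj (a :: l ++ [a])) :
    wp (crsM q) (a :: l ++ [a]) = wp (crsM q') (a :: l ++ [a]) := by
  have key : ∀ q q' : ℤ × ℤ, q ∉ S → q' ∉ S →
      (q' = q ∨ q' = (q.1, q.2 + 1) ∨ q' = (q.1 + 1, q.2) ∨ q' = (q.1 + 1, q.2 + 1)) →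
      wp (crsM q) (a :: l ++ [a]) = wp (crsM q') (a :: l ++ [a]) := by
    intro q q' hq hq' hcase
    have ex := crs_step q q' S hq hq' hcase
    obtain ⟨g, hg⟩ := ex
    have := wp_crsM_step_aux q q' g S hg a l a hl hc
    apply Multiplicative.toAdd.injective
    omega
  obtain ⟨x, y⟩ := q
  obtain ⟨x', y'⟩ := q'
  unfold hadj at hqq
  simp at hqq
  have : ((x', y') = (x, y) ∨ (x',y') = (x, y + 1) ∨ (x',y') = (x + 1, y) ∨ (x',y') = (x + 1, y + 1)) ∨
     ((x, y) = (x', y') ∨ (x,y) = (x', y' + 1) ∨ (x,y) = (x' + 1, y') ∨ (x,y) = (x' + 1, y' + 1)) := by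
    simp only [Prod.mk.injEq]
    omega
  rcases this with h | h
  · exact key _ _ hq hq' h
  · exact (key _ _ hq' hq h).symm

lemma wp_eq_one_of {V G : Type*} [Group G] (e : V → V → G) (l : List V)
    (h : ∀ u ∈ l, ∀ w ∈ l, e u w = 1) : wp e l = 1 := by
  induction l with
  | nil => rfl
  | cons a l ih =>
    cases l with
    | nil => rfl
    | cons b l =>
      rw [wp_cons_cons, h a (by simp) b (by simp), ih, one_mul]
      intro u hu w hw
      exact h u (List.mem_cons_of_mem _ hu) w (List.mem_cons_of_mem _ hw)

/-- fullness -/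
def Full (W : Set (ℤ × ℤ)) : Prop :=
  ∀ q, q ∉ W → ∃ q', Relation.ReflTransGen (fun a b => hadj a b ∧ a ∉ W ∧ b ∉ W) q q' ∧
    ∀ w ∈ W, w.2 ≤ q'.2

lemma wp_crsM_full (W : Set (ℤ × ℤ)) (hW : Full W) (q : ℤ × ℤ) (hq : q ∉ W)
    (a : ℤ × ℤ) (l : List (ℤ × ℤ))
    (hl : ∀ x ∈ a :: l ++ [a], x ∈ W) (hc : List.IsChain hadj (a :: l ++ [a])) :
    wp (crsM q) (a :: l ++ [a]) = 1 := by
  obtain ⟨q', hr, hq'⟩ := hW q hq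
  induction hr using Relation.ReflTransGen.head_induction_on with
  | refl =>
    apply wp_eq_one_of
    intro u hu w hw
    have h1 := hq' u (hl u hu)
    have h2 := hq' w (hl w hw)
    have : crs q' u w = 0 := by
      unfold crs; split_ifs <;> omega
    simp [crsM, this]
  | head h _ ih =>
    rw [wp_crsM_step _ _ W h.2.1 h.2.2 h.1 a l hl hc]
    exact ih h.2.2

set_option maxHeartbeats 2000000 in
theorem wp_closed {G : Type*} [Group G] (e : ℤ × ℤ → ℤ × ℤ → G) (W : Set (ℤ × ℤ)) (hW : Full W)
    (m : ℤ) (hm : ∀ w ∈ W, m ≤ w.2)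
    (he : ∀ p ∈ W, ∀ q ∈ W, ∀ r ∈ W, hadj p q → hadj q r → hadj p r → e p q * e q r = e p r)
    (n : ℕ) : ∀ (k : ℕ) (a : ℤ × ℤ) (l : List (ℤ × ℤ)), l.length = n →
      ((a :: l).map (fun z => (z.2 - m).toNat)).sum = k →
      (∀ x ∈ a :: l, x ∈ W) → List.IsChain hadj (a :: l ++ [a]) → wp e (a :: l ++ [a]) = 1 := by
  have e1 : ∀ p ∈ W, e p p = 1 := by
    intro p hp
    have := he p hp p hp p hp (hadj_refl p) (hadj_refl p) (hadj_refl p)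
    simpa using this
  induction n using Nat.strong_induction_on with | _ n ihn
  intro k
  induction k using Nat.strong_induction_on with | _ k ihk
  intro a l hn hk hl hc
  -- top-left vertex
  obtain ⟨v, hv, hvmax⟩ : ∃ v ∈ a :: l, ∀ x ∈ a :: l, x.2 < v.2 ∨ (x.2 = v.2 ∧ v.1 ≤ x.1) := by
    obtain ⟨v, hv, hvm⟩ := (a :: l).toFinset.exists_max_image
      (fun x : ℤ × ℤ => (toLex (x.2, -x.1) : ℤ ×ₗ ℤ)) ⟨a, by simp⟩
    refine ⟨v, by simpa using hv, fun x hx => ?_⟩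
    have := hvm x (by simpa using hx)
    rw [Prod.Lex.toLex_le_toLex] at this
    simp at this; omega
  -- rotation
  obtain ⟨t, ht_perm, ht_chain, ht_imp⟩ : ∃ t, (v :: t).Perm (a :: l) ∧
      List.IsChain hadj (v :: t ++ [v]) ∧
      (wp e (v :: t ++ [v]) = 1 → wp e (a :: l ++ [a]) = 1) := by
    obtain ⟨xs, ys, hxy⟩ := List.append_of_mem hv
    cases xs with
    | nil =>
      simp at hxy
      obtain ⟨rfl, rfl⟩ := hxy
      exact ⟨l, List.Perm.refl _, hc, id⟩
    | cons b xs =>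
      simp at hxy
      obtain ⟨rfl, rfl⟩ := hxy
      refine ⟨ys ++ a :: xs, ?_, ?_, ?_⟩
      · have : v :: (ys ++ a :: xs) = (v :: ys) ++ (a :: xs) := by simp
        rw [this]
        exact List.perm_append_comm.trans (by simp)
      · have h1 : a :: (xs ++ v :: ys) ++ [a] = (a :: xs) ++ v :: (ys ++ [a]) := by simp
        rw [h1, List.isChain_split] at hc
        have h2 : v :: (ys ++ a :: xs) ++ [v] = (v :: ys) ++ a :: (xs ++ [v]) := by simp
        rw [h2, List.isChain_split]
        exact ⟨by simpa using hc.2, by simpa using hc.1⟩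
      · have h1 : a :: (xs ++ v :: ys) ++ [a] = (a :: xs) ++ v :: (ys ++ [a]) := by simp
        have h2 : v :: (ys ++ a :: xs) ++ [v] = (v :: ys) ++ a :: (xs ++ [v]) := by simp
        rw [h1, h2, wp_append e (a :: xs) v (ys ++ [a]), wp_append e (v :: ys) a (xs ++ [v])]
        intro h
        have h' := eq_inv_of_mul_eq_one_left h
        simp only [List.cons_append] at h' ⊢
        rw [h']; simp
  apply ht_imp
  have hlen : t.length = n := by have := ht_perm.length_eq; simp at this; omega
  have hsum : ((v :: t).map (fun z => (z.2 - m).toNat)).sum = k := by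
    rw [← hk]; exact (ht_perm.map _).sum_eq
  have htW : ∀ x ∈ v :: t, x ∈ W := fun x hx => hl x (ht_perm.mem_iff.1 hx)
  have htmax : ∀ x ∈ v :: t, x.2 < v.2 ∨ (x.2 = v.2 ∧ v.1 ≤ x.1) :=
    fun x hx => hvmax x (ht_perm.mem_iff.1 hx)
  clear ht_imp ht_perm hvmax hc hl hk hn
  have hvW : v ∈ W := htW v (by simp)
  by_cases hvt : v ∈ t
  · obtain ⟨xs, ys, rfl⟩ := List.append_of_mem hvt
    have h1 : v :: (xs ++ v :: ys) ++ [v] = (v :: xs) ++ v :: (ys ++ [v]) := by simp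
    rw [h1, List.isChain_split] at ht_chain
    rw [h1, wp_append]
    have hlx : xs.length < n := by simp at hlen; omega
    have hly : ys.length < n := by simp at hlen; omega
    have A := ihn _ hlx _ v xs rfl rfl (fun x hx => htW x (by simp at hx ⊢; tauto)) ht_chain.1
    have B := ihn _ hly _ v ys rfl rfl (fun x hx => htW x (by simp at hx ⊢; tauto)) (by simpa using ht_chain.2)
    rw [A]; simp only [List.cons_append] at B; rw [B, one_mul]
  rcases t with _ | ⟨u, t⟩
  · simp [e1 v hvW]
  rcases List.eq_nil_or_concat t with rfl | ⟨s, w, rfl⟩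
  · have huW := htW u (by simp)
    simp at ht_chain
    simp [he v hvW u huW v hvW ht_chain.1 ht_chain.2 (hadj_refl v), e1 v hvW]
  -- general
  have huW := htW u (by simp)
  have hwW := htW w (by simp)
  have form : v :: (u :: (s ++ [w])) ++ [v] = [v] ++ (u :: s ++ w :: [v]) := by simp
  simp only [List.concat_eq_append] at *
  have hvu : hadj v u := by simp at ht_chain; exact ht_chain.1
  have hch2 : List.IsChain hadj (u :: s ++ w :: [v]) := by
    rw [form] at ht_chain; exact ht_chain.tail
  rw [List.isChain_split] at hch2
  have hwv : hadj w v := by simpa using hch2.2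
  have hus : List.IsChain hadj (u :: s ++ [w]) := hch2.1
  have hP : wp e (v :: (u :: (s ++ [w])) ++ [v]) = e v u * wp e (u :: s ++ [w]) * e w v := by
    rw [form]
    have : [v] ++ (u :: s ++ w :: [v]) = (v :: u :: s) ++ w :: [v] := by simp
    rw [this, wp_append]
    simp
  rw [hP]
  by_cases hwu : hadj w u
  · -- shortcut
    have hlt : (s ++ [w]).length < n := by simp at hlen ⊢; omega
    have A := ihn _ hlt _ u (s ++ [w]) rfl rfl (fun x hx => htW x (List.mem_cons_of_mem _ hx)) (by
      have : u :: (s ++ [w]) ++ [u] = (u :: s) ++ w :: [u] := by simp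
      rw [this, List.isChain_split]
      exact ⟨hus, by simpa using hwu⟩)
    have h3 : u :: (s ++ [w]) ++ [u] = (u :: s) ++ w :: [u] := by simp
    rw [h3, wp_append] at A
    simp only [wp_cons_cons, wp_single, mul_one] at A
    rw [← he w hwW v hvW u huW hwv hvu hwu] at A
    have := eq_inv_of_mul_eq_one_left A
    rw [this]; group
  · -- push across
    set b : ℤ × ℤ := (v.1, v.2 - 1) with hb
    have hune : u ≠ v := by rintro rfl; simp at hvt
    have hwne : w ≠ v := by rintro rfl; simp at hvt
    have hune' : u.1 ≠ v.1 ∨ u.2 ≠ v.2 := by by_contra! h; exact hune (Prod.ext h.1 h.2)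
    have hwne' : w.1 ≠ v.1 ∨ w.2 ≠ v.2 := by by_contra! h; exact hwne (Prod.ext h.1 h.2)
    have hu1 := htmax u (by simp)
    have hw1 := htmax w (by simp)
    have hcase := push_case u v w hvu hwv hwu hune' hwne' hu1 hw1
    have hbw : hadj w b := by clear_value b; subst hb; clear hvu hwv hwu; simp only [hadj]; omega
    have hbu : hadj b u := by clear_value b; subst hb; clear hvu hwv hwu; simp only [hadj]; omega
    have hbv : hadj b v := by clear_value b; subst hb; clear hvu hwv hwu; simp only [hadj]; omega
    have hbW : b ∈ W := by
      by_contra hbW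
      have h0 := wp_crsM_full W hW b hbW v (u :: (s ++ [w])) (by
        intro x hx
        apply htW
        simp at hx ⊢; tauto) ht_chain
      have hmid : wp (crsM b) (u :: s ++ [w]) = 1 := by
        apply wp_eq_one_of
        intro x hx y hy
        have hx1 := htmax x (List.mem_cons_of_mem _ (by simpa using hx))
        have hy1 := htmax y (List.mem_cons_of_mem _ (by simpa using hy))
        have hxv : x ≠ v := by rintro rfl; exact hvt (by simpa using hx)
        have hyv : y ≠ v := by rintro rfl; exact hvt (by simpa using hy)
        have hx' : x.1 ≠ v.1 ∨ x.2 ≠ v.2 := by by_contra! h; exact hxv (Prod.ext h.1 h.2)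
        have hy' : y.1 ≠ v.1 ∨ y.2 ≠ v.2 := by by_contra! h; exact hyv (Prod.ext h.1 h.2)
        have : crs b x y = 0 := by
          simp only [crs, hb]
          split_ifs <;> omega
        simp [crsM, this]
      rw [form] at h0
      have : [v] ++ (u :: s ++ w :: [v]) = (v :: u :: s) ++ w :: [v] := by simp
      rw [this, wp_append] at h0
      simp only [List.cons_append, wp_cons_cons, wp_single, mul_one] at h0 hmid
      rw [hmid, mul_one] at h0
      have h0' : crs b v u + crs b w v = 0 := by
        have := congrArg Multiplicative.toAdd h0
        simpa [crsM] using this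
      exact crs_push u v w hcase h0'
    have hk' : ((b :: (u :: (s ++ [w]))).map (fun z => (z.2 - m).toNat)).sum < k := by
      rw [← hsum]
      simp only [List.map_cons, List.sum_cons]
      have : (b.2 - m).toNat < (v.2 - m).toNat := by
        have := hm b hbW
        simp only [hb] at *
        omega
      omega
    have A := ihk _ hk' b (u :: (s ++ [w])) (by simpa using hlen) rfl (by
        intro x hx
        rcases List.mem_cons.1 hx with rfl | hx
        · exact hbW
        · exact htW x (List.mem_cons_of_mem _ hx)) (by
      have : b :: (u :: (s ++ [w])) ++ [b] = (b :: u :: s) ++ w :: [b] := by simp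
      rw [this, List.isChain_split]
      refine ⟨?_, by simpa using hbw⟩
      simp only [List.cons_append, List.isChain_cons_cons]
      exact ⟨hbu, hus⟩)
    have h3 : b :: (u :: (s ++ [w])) ++ [b] = (b :: u :: s) ++ w :: [b] := by simp
    rw [h3, wp_append] at A
    simp only [List.cons_append, wp_cons_cons, wp_single, mul_one] at A
    rw [← he b hbW v hvW u huW hbv hvu hbu, ← he w hwW v hvW b hbW hwv (hadj_symm hbv) hbw] at A
    have hvb : e v b = (e b v)⁻¹ := by
      apply eq_inv_of_mul_eq_one_left
      rw [he v hvW b hbW v hvW (hadj_symm hbv) hbv (hadj_refl v), e1 v hvW]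
    rw [hvb] at A
    simp only [List.cons_append]
    have : e b v * (e v u * wp e (u :: (s ++ [w])) * e w v) * (e b v)⁻¹ = 1 := by
      rw [← A]; group
    rw [mul_inv_eq_one] at this
    simpa using this

/-! ### Part 2: hexagonal balls and simple connectivity -/

/-- open star of the lattice point `p` -/
def hball (p : ℤ × ℤ) : Set (ℝ × ℝ) :=
  {z | |z.1 - p.1| < 1 ∧ |z.2 - p.2| < 1 ∧ |(z.1 - z.2) - (p.1 - p.2)| < 1}

lemma hball_convex (p : ℤ × ℤ) : Convex ℝ (hball p) := by
  intro x hx y hy a b ha hb hab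
  simp only [hball, mem_ofPred_eq, abs_lt] at *
  obtain rfl : b = 1 - a := by linarith
  have ha1 : a ≤ 1 := by linarith
  simp only [Prod.fst_add, Prod.snd_add, Prod.smul_fst, Prod.smul_snd, smul_eq_mul]
  have key : ∀ (u v c : ℝ), u < c → v < c → a * u + (1 - a) * v < c := by
    intro u v c hu hv
    rcases eq_or_lt_of_le ha with h | h
    · subst h; linarith
    · nlinarith
  have key' : ∀ (u v c : ℝ), c < u → c < v → c < a * u + (1 - a) * v := by
    intro u v c hu hv
    rcases eq_or_lt_of_le ha with h | h
    · subst h; linarith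
    · nlinarith
  obtain ⟨⟨x1, x2⟩, ⟨x3, x4⟩, x5, x6⟩ := hx
  obtain ⟨⟨y1, y2⟩, ⟨y3, y4⟩, y5, y6⟩ := hy
  refine ⟨⟨?_, ?_⟩, ⟨?_, ?_⟩, ?_, ?_⟩
  · have := key' _ _ _ x1 y1; linarith
  · have := key _ _ _ x2 y2; linarith
  · have := key' _ _ _ x3 y3; linarith
  · have := key _ _ _ x4 y4; linarith
  · have := key' _ _ _ x5 y5; linarith
  · have := key _ _ _ x6 y6; linarith

lemma hball_open (p : ℤ × ℤ) : IsOpen (hball p) := by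
  refine IsOpen.and ?_ (IsOpen.and ?_ ?_)
  all_goals exact isOpen_lt (by fun_prop) (by fun_prop)

/-- the centre -/
def hc (p : ℤ × ℤ) : ℝ × ℝ := ((p.1 : ℝ), (p.2 : ℝ))

lemma hc_mem (p : ℤ × ℤ) : hc p ∈ hball p := by
  simp [hball, hc]

lemma hadj_of_mem {p q : ℤ × ℤ} {z : ℝ × ℝ} (hp : z ∈ hball p) (hq : z ∈ hball q) : hadj p q := by
  simp only [hball, mem_ofPred_eq, abs_lt] at *
  have key : ∀ a b : ℤ, (a : ℝ) - b < 2 → a - b ≤ 1 := by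
    intro a b h
    have : a - b < 2 := by exact_mod_cast h
    omega
  refine ⟨key _ _ (by linarith), key _ _ (by linarith), key _ _ (by linarith), key _ _ (by linarith),
    key _ _ (by push_cast; linarith), key _ _ (by push_cast; linarith)⟩

lemma exists_triple {p q r : ℤ × ℤ} (h1 : hadj p q) (h2 : hadj q r) (h3 : hadj p r) :
    ∃ z, z ∈ hball p ∧ z ∈ hball q ∧ z ∈ hball r := by
  have cast : ∀ p q : ℤ × ℤ, hadj p q → (p.1 : ℝ) - q.1 ≤ 1 ∧ (q.1 : ℝ) - p.1 ≤ 1 ∧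
      (p.2 : ℝ) - q.2 ≤ 1 ∧ (q.2 : ℝ) - p.2 ≤ 1 ∧
      ((p.1 : ℝ) - p.2) - (q.1 - q.2) ≤ 1 ∧ ((q.1 : ℝ) - q.2) - (p.1 - p.2) ≤ 1 := by
    intro p q h
    unfold hadj at h
    exact_mod_cast h
  replace h1 := cast _ _ h1
  replace h2 := cast _ _ h2
  replace h3 := cast _ _ h3
  refine ⟨(((p.1 : ℝ) + q.1 + r.1) / 3, ((p.2 : ℝ) + q.2 + r.2) / 3), ?_, ?_, ?_⟩ <;>
  · simp only [hball, mem_ofPred_eq, abs_lt]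
    refine ⟨⟨?_, ?_⟩, ⟨?_, ?_⟩, ?_, ?_⟩ <;> linarith

lemma sigma_prod {G : Type*} [Group G] (σ : ℝ × ℝ → ℝ × ℝ → G) (W : Set (ℤ × ℤ))
    (hσ : ∀ p ∈ W, ∀ x ∈ hball p, ∀ y ∈ hball p, ∀ z ∈ hball p, σ x y * σ y z = σ x z)
    (hW : Full W) (m : ℤ) (hm : ∀ w ∈ W, m ≤ w.2)
    (x : ℕ → ℝ × ℝ) (p : ℕ → ℤ × ℤ) (hp : ∀ n, p n ∈ W) (hx : ∀ n, x n ∈ hball (p n))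
    (hx' : ∀ n, x (n + 1) ∈ hball (p n)) (P : ℕ → G) (hP0 : P 0 = 1)
    (hP : ∀ n, P (n + 1) = P n * σ (x n) (x (n + 1))) (M : ℕ) (hM : x M = x 0) : P M = 1 := by
  have s1 : ∀ p ∈ W, ∀ x ∈ hball p, σ x x = 1 := by
    intro p hp x hx
    simpa using hσ p hp x hx x hx x hx
  have sinv : ∀ p ∈ W, ∀ x ∈ hball p, ∀ y ∈ hball p, σ x y * σ y x = 1 := by
    intro p hp x hx y hy
    rw [hσ p hp x hx y hy x hx, s1 p hp x hx]
  classical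
  let mid : ℤ × ℤ → ℤ × ℤ → ℝ × ℝ := fun p q =>
    if h : ∃ z, z ∈ hball p ∧ z ∈ hball q then h.choose else 0
  let e : ℤ × ℤ → ℤ × ℤ → G := fun p q => σ (hc p) (mid p q) * σ (mid p q) (hc q)
  have he : ∀ p ∈ W, ∀ q ∈ W, ∀ z, z ∈ hball p → z ∈ hball q → e p q = σ (hc p) z * σ z (hc q) := by
    intro p hp q hq z hzp hzq
    have h : ∃ z, z ∈ hball p ∧ z ∈ hball q := ⟨z, hzp, hzq⟩
    have hmid : mid p q = h.choose := by simp only [mid]; rw [dif_pos h]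
    have hs := h.choose_spec
    rw [← hmid] at hs
    simp only [e]
    rw [← hσ p hp _ (hc_mem p) (mid p q) hs.1 z hzp, mul_assoc,
      hσ q hq _ hs.2 z hzq _ (hc_mem q)]
  have het : ∀ p ∈ W, ∀ q ∈ W, ∀ r ∈ W, hadj p q → hadj q r → hadj p r → e p q * e q r = e p r := by
    intro p hp q hq r hr h1 h2 h3
    obtain ⟨z, hzp, hzq, hzr⟩ := exists_triple h1 h2 h3
    rw [he p hp q hq z hzp hzq, he q hq r hr z hzq hzr, he p hp r hr z hzp hzr]
    have := sinv q hq z hzq (hc q) (hc_mem q)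
    calc _ = σ (hc p) z * (σ z (hc q) * σ (hc q) z) * σ z (hc r) := by group
      _ = _ := by rw [this, mul_one]
  have adj : ∀ n, hadj (p n) (p (n + 1)) := fun n => hadj_of_mem (hx' n) (hx (n + 1))
  have claim : ∀ n, P n = σ (x 0) (hc (p 0)) * wp e ((List.range n).map p ++ [p n]) *
      σ (hc (p n)) (x n) ∧ List.IsChain hadj ((List.range n).map p ++ [p n]) := by
    intro n
    induction n with
    | zero => simp [hP0, sinv _ (hp 0) _ (hx 0) _ (hc_mem _)]
    | succ n ih =>
      have hl : (List.range (n + 1)).map p ++ [p (n + 1)] =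
        (List.range n).map p ++ p n :: [p (n + 1)] := by
        rw [List.range_succ]; simp
      constructor
      · rw [hP, ih.1, hl, wp_append e _ (p n) [p (n+1)]]
        simp only [wp_cons_cons, wp_single, mul_one]
        rw [he _ (hp n) _ (hp (n + 1)) _ (hx' n) (hx (n + 1))]
        have := sinv _ (hp (n+1)) _ (hx (n + 1)) _ (hc_mem _)
        rw [mul_assoc, hσ _ (hp n) _ (hc_mem _) _ (hx n) _ (hx' n)]
        simp only [mul_assoc]
        rw [this, mul_one]
      · rw [hl, List.isChain_split]
        exact ⟨ih.2, by simpa using adj n⟩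
  obtain ⟨h1, h2⟩ := claim M
  have hxM : x 0 ∈ hball (p M) := hM ▸ hx M
  -- close up
  have hcl : wp e ((List.range M).map p ++ [p M] ++ [p 0]) = 1 ∧ 
      wp e ((List.range M).map p ++ [p M] ++ [p 0]) =
        wp e ((List.range M).map p ++ [p M]) * e (p M) (p 0) := by
    refine ⟨?_, ?_⟩
    · have : ∃ l, (List.range M).map p ++ [p M] = p 0 :: l := by
        cases M with
        | zero => exact ⟨[], by simp⟩
        | succ k => rw [List.range_succ_eq_map]; simp
      obtain ⟨l, hl⟩ := this
      rw [hl]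
      refine wp_closed e W hW m hm het _ _ (p 0) l rfl rfl ?_ ?_
      · rw [← hl]
        intro y hy
        simp at hy
        rcases hy with ⟨k, -, rfl⟩ | rfl
        · exact hp k
        · exact hp M
      · rw [← hl]
        have : (List.range M).map p ++ [p M] ++ [p 0] = (List.range M).map p ++ p M :: [p 0] := by simp
        rw [this, List.isChain_split]
        exact ⟨h2, by simpa using hadj_of_mem hxM (hx 0)⟩
    · have : (List.range M).map p ++ [p M] ++ [p 0] = (List.range M).map p ++ p M :: [p 0] := by simp
      rw [this, wp_append e]
      simp
  rw [hcl.1, he _ (hp M) _ (hp 0) _ hxM (hx 0)] at hcl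
  have h3 := hcl.2
  rw [hM] at h1
  rw [h1]
  have := eq_inv_of_mul_eq_one_left h3.symm
  rw [this]
  group

/-- loops at `x` up to homotopy, multiplication being concatenation -/
def LoopG {X : Type*} [TopologicalSpace X] (x : X) : Type _ := Path.Homotopic.Quotient x x

instance {X : Type*} [TopologicalSpace X] (x : X) : Group (LoopG x) where
  mul p q := Path.Homotopic.Quotient.trans p q
  one := Path.Homotopic.Quotient.refl x
  inv p := Path.Homotopic.Quotient.symm p
  mul_assoc p q r := Path.Homotopic.Quotient.trans_assoc p q r
  one_mul p := Path.Homotopic.Quotient.refl_trans p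
  mul_one p := Path.Homotopic.Quotient.trans_refl p
  inv_mul_cancel p := Path.Homotopic.Quotient.symm_trans p

/-- conjugate a path class to a loop class at the base point -/
def toLoop {X : Type*} [TopologicalSpace X] {x₀ : X} (a : ∀ x : X, Path.Homotopic.Quotient x₀ x)
    {x y : X} (q : Path.Homotopic.Quotient x y) : LoopG x₀ :=
  ((a x).trans q).trans (a y).symm

lemma toLoop_trans {X : Type*} [TopologicalSpace X] {x₀ : X}
    (a : ∀ x : X, Path.Homotopic.Quotient x₀ x) {x y z : X} (q : Path.Homotopic.Quotient x y)
    (r : Path.Homotopic.Quotient y z) : toLoop a (q.trans r) = toLoop a q * toLoop a r := by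
  change _ = Path.Homotopic.Quotient.trans (((a x).trans q).trans (a y).symm)
    (((a y).trans r).trans (a z).symm)
  unfold toLoop
  simp only [Path.Homotopic.Quotient.trans_assoc]
  rw [← Path.Homotopic.Quotient.trans_assoc (a y).symm (a y)]
  simp

lemma toLoop_refl {X : Type*} [TopologicalSpace X] {x₀ : X}
    (a : ∀ x : X, Path.Homotopic.Quotient x₀ x) (x : X) :
    toLoop a (Path.Homotopic.Quotient.refl x) = 1 := by
  unfold toLoop
  simp
  rfl

lemma null_of_toLoop_cast {X : Type*} [TopologicalSpace X] {x₀ : X}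
    (a : ∀ x : X, Path.Homotopic.Quotient x₀ x) {x y : X} (b : X) (γ : Path b b) (hx : x = b) (hy : y = b)
    (h : toLoop a (Path.Homotopic.Quotient.mk (γ.cast hx hy)) = 1) : γ.Homotopic (Path.refl b) := by
  subst hx
  subst hy
  rw [← Path.Homotopic.Quotient.eq]
  have h' : ((a y).trans (.mk γ)).trans (a y).symm = Path.Homotopic.Quotient.refl x₀ := h
  calc Path.Homotopic.Quotient.mk γ
      = (a y).symm.trans ((((a y).trans (.mk γ)).trans (a y).symm).trans (a y)) := by
        simp only [Path.Homotopic.Quotient.trans_assoc]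
        rw [← Path.Homotopic.Quotient.trans_assoc (a y).symm (a y)]
        simp
    _ = _ := by rw [h']; simp

lemma homotopic_of_convex {U C : Set (ℝ × ℝ)} (hC : Convex ℝ C) (hCU : C ⊆ U) {x y : U}
    (δ₁ δ₂ : Path x y) (h₁ : ∀ t, (δ₁ t).1 ∈ C) (h₂ : ∀ t, (δ₂ t).1 ∈ C) : δ₁.Homotopic δ₂ := by
  have hx : x.1 ∈ C := by simpa using h₁ 0
  have hy : y.1 ∈ C := by simpa using h₁ 1
  have : ContractibleSpace C := hC.contractibleSpace ⟨_, hx⟩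
  let lift : ∀ δ : Path x y, (∀ t, (δ t).1 ∈ C) → Path (⟨x.1, hx⟩ : C) ⟨y.1, hy⟩ := fun δ h =>
    { toFun := fun t => ⟨(δ t).1, h t⟩
      continuous_toFun := by fun_prop
      source' := by simp
      target' := by simp }
  have hh := SimplyConnectedSpace.paths_homotopic (lift δ₁ h₁) (lift δ₂ h₂)
  have := hh.map (⟨Set.inclusion hCU, continuous_inclusion hCU⟩ : C(C, U))
  exact this

lemma exists_path_convex {U C : Set (ℝ × ℝ)} (hC : Convex ℝ C) (hCU : C ⊆ U) {x y : U}
    (hx : x.1 ∈ C) (hy : y.1 ∈ C) : ∃ δ : Path x y, ∀ t, (δ t).1 ∈ C := by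
  have := hC.isPathConnected ⟨_, hx⟩
  obtain ⟨δ, hδ⟩ := this.joinedIn _ hx _ hy
  exact ⟨{ toFun := fun t => ⟨δ t, hCU (hδ t)⟩
           continuous_toFun := by fun_prop
           source' := by simp
           target' := by simp }, hδ⟩

/-- the union of stars -/
def hU (W : Set (ℤ × ℤ)) : Set (ℝ × ℝ) := ⋃ p ∈ W, hball p

lemma hball_sub {W : Set (ℤ × ℤ)} {p : ℤ × ℤ} (hp : p ∈ W) : hball p ⊆ hU W :=
  subset_biUnion_of_mem (u := hball) hp

lemma hU_open (W : Set (ℤ × ℤ)) : IsOpen (hU W) :=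
  isOpen_biUnion fun p _ => hball_open p

/-- local path classes -/
def locP (W : Set (ℤ × ℤ)) {x y : hU W} (h : ∃ p ∈ W, x.1 ∈ hball p ∧ y.1 ∈ hball p) : Path x y :=
  (exists_path_convex (hball_convex h.choose) (hball_sub h.choose_spec.1)
    h.choose_spec.2.1 h.choose_spec.2.2).choose

lemma locP_spec (W : Set (ℤ × ℤ)) {x y : hU W} (h : ∃ p ∈ W, x.1 ∈ hball p ∧ y.1 ∈ hball p)
    (p : ℤ × ℤ) (hp : p ∈ W) (δ : Path x y) (hδ : ∀ t, (δ t).1 ∈ hball p) :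
    δ.Homotopic (locP W h) := by
  have h0 := (exists_path_convex (hball_convex h.choose) (hball_sub h.choose_spec.1)
    h.choose_spec.2.1 h.choose_spec.2.2).choose_spec
  have hx : x.1 ∈ hball p := by simpa using hδ 0
  have hy : y.1 ∈ hball p := by simpa using hδ 1
  obtain ⟨δ', hδ'⟩ := exists_path_convex (U := hU W) (x := x) (y := y)
    ((hball_convex p).inter (hball_convex h.choose))
    (inter_subset_left.trans (hball_sub hp)) ⟨hx, h.choose_spec.2.1⟩ ⟨hy, h.choose_spec.2.2⟩
  exact (homotopic_of_convex (hball_convex p) (hball_sub hp) δ δ' hδ (fun t => (hδ' t).1)).trans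
    (homotopic_of_convex (hball_convex h.choose) (hball_sub h.choose_spec.1) δ' _
      (fun t => (hδ' t).2) h0)

lemma hU_pathConnected (W : Set (ℤ × ℤ)) (hne : W.Nonempty)
    (hconn : ∀ p ∈ W, ∀ q ∈ W,
      Relation.ReflTransGen (fun a b => hadj a b ∧ a ∈ W ∧ b ∈ W) p q) :
    IsPathConnected (hU W) := by
  obtain ⟨p, hp⟩ := hne
  refine ⟨hc p, hball_sub hp (hc_mem p), ?_⟩
  intro y hy
  simp only [hU, mem_iUnion] at hy
  obtain ⟨q, hq, hyq⟩ := hy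
  have inball : ∀ r ∈ W, ∀ x ∈ hball r, ∀ y ∈ hball r, JoinedIn (hU W) x y := by
    intro r hr x hx y hy
    exact (((hball_convex r).isPathConnected ⟨_, hx⟩).joinedIn _ hx _ hy).mono (hball_sub hr)
  have : JoinedIn (hU W) (hc p) (hc q) := by
    have hr := hconn p hp q hq
    clear hyq hq
    induction hr with
    | refl => exact inball p hp _ (hc_mem p) _ (hc_mem p)
    | tail _ h ih =>
      rename_i b c _
      obtain ⟨z, hz1, hz2, -⟩ := exists_triple h.1 (hadj_refl c) h.1
      exact (ih.trans (inball b h.2.1 _ (hc_mem b) _ hz1)).trans (inball c h.2.2 _ hz2 _ (hc_mem c))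
  exact this.trans (inball q hq _ (hc_mem q) _ hyq)

theorem hU_simplyConnected (W : Set (ℤ × ℤ)) (hne : W.Nonempty)
    (hconn : ∀ p ∈ W, ∀ q ∈ W,
      Relation.ReflTransGen (fun a b => hadj a b ∧ a ∈ W ∧ b ∈ W) p q)
    (hW : Full W) (m : ℤ) (hm : ∀ w ∈ W, m ≤ w.2) : SimplyConnectedSpace (hU W) := by
  have hpc := isPathConnected_iff_pathConnectedSpace.1 (hU_pathConnected W hne hconn)
  rw [simply_connected_iff_loops_nullhomotopic]
  refine ⟨hpc, fun b γ => ?_⟩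
  let a : ∀ x : hU W, Path.Homotopic.Quotient b x := fun x =>
    Path.Homotopic.Quotient.mk (PathConnectedSpace.somePath b x)
  classical
  let σ : ℝ × ℝ → ℝ × ℝ → LoopG b := fun x y =>
    if h : (∃ p ∈ W, x ∈ hball p ∧ y ∈ hball p) then
      toLoop a (Path.Homotopic.Quotient.mk (locP W (x := ⟨x, by
        obtain ⟨p, hp, h1, h2⟩ := h; exact hball_sub hp h1⟩) (y := ⟨y, by
        obtain ⟨p, hp, h1, h2⟩ := h; exact hball_sub hp h2⟩) h)) else 1
  have hσ0 : ∀ (x y : hU W) (p : ℤ × ℤ), p ∈ W → ∀ δ : Path x y, (∀ t, (δ t).1 ∈ hball p) →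
      σ x.1 y.1 = toLoop a (.mk δ) := by
    intro x y p hp δ hδ
    have hx : x.1 ∈ hball p := by simpa using hδ 0
    have hy : y.1 ∈ hball p := by simpa using hδ 1
    have h : ∃ p ∈ W, x.1 ∈ hball p ∧ y.1 ∈ hball p := ⟨p, hp, hx, hy⟩
    simp only [σ]
    rw [dif_pos h]
    congr 1
    exact (Path.Homotopic.Quotient.eq.2 (locP_spec W h p hp δ hδ)).symm
  have hσ : ∀ p ∈ W, ∀ x ∈ hball p, ∀ y ∈ hball p, ∀ z ∈ hball p, σ x y * σ y z = σ x z := by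
    intro p hp x hx y hy z hz
    obtain ⟨δ, hδ⟩ := exists_path_convex (hball_convex p) (hball_sub hp)
      (x := ⟨x, hball_sub hp hx⟩) (y := ⟨y, hball_sub hp hy⟩) hx hy
    obtain ⟨δ', hδ'⟩ := exists_path_convex (hball_convex p) (hball_sub hp)
      (x := ⟨y, hball_sub hp hy⟩) (y := ⟨z, hball_sub hp hz⟩) hy hz
    have h1 := hσ0 _ _ p hp δ hδ
    have h2 := hσ0 _ _ p hp δ' hδ'
    have h3 := hσ0 _ _ p hp (δ.trans δ') (by
      intro t
      rw [Path.trans_apply]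
      split_ifs
      · exact hδ _
      · exact hδ' _)
    simp only at h1 h2 h3
    rw [h1, h2, h3, Path.Homotopic.Quotient.mk_trans, toLoop_trans]
  obtain ⟨t, ht0, htm, ⟨M, hM⟩, hcov⟩ := exists_monotone_Icc_subset_open_cover_unitInterval
    (c := fun p : W => {s | (γ s).1 ∈ hball p.1})
    (fun p => (hball_open p.1).preimage (by fun_prop))
    (fun s _ => by
      have := (γ s).2
      simp only [hU, mem_iUnion] at this
      obtain ⟨p, hp, h⟩ := this
      exact mem_iUnion.2 ⟨⟨p, hp⟩, h⟩)
  choose p hp using hcov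
  have hPM := sigma_prod σ W hσ hW m hm (fun n => (γ (t n)).1) (fun n => (p n).1) (fun n => (p n).2)
    (fun n => hp n ⟨le_rfl, htm (Nat.le_succ n)⟩) (fun n => hp n ⟨htm (Nat.le_succ n), le_rfl⟩)
    (fun n => toLoop a (.mk (γ.subpath (t 0) (t n)))) (by
      simp only [Path.subpath_self]
      exact toLoop_refl a _) (by
      intro n
      rw [hσ0 _ _ (p n).1 (p n).2 (γ.subpath (t n) (t (n + 1))) (by
        intro s
        have : γ.subpath (t n) (t (n + 1)) s ∈ range (γ.subpath (t n) (t (n + 1))) := ⟨s, rfl⟩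
        rw [Path.range_subpath_of_le _ _ _ (htm (Nat.le_succ n))] at this
        obtain ⟨r, hr, hr'⟩ := this
        rw [← hr']
        exact hp n hr), ← toLoop_trans, ← Path.Homotopic.Quotient.mk_trans]
      congr 1
      exact (Path.Homotopic.Quotient.eq.2 ⟨Path.Homotopy.subpathTransSubpath γ _ _ _⟩).symm) M (by
      simp [hM M le_rfl, ht0])
  have key : ∀ s u, s = 0 → u = 1 → toLoop a (.mk (γ.subpath s u)) = 1 →
      toLoop a (.mk (γ.subpath 0 1)) = 1 := by
    rintro _ _ rfl rfl h
    exact h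
  have hPM := key _ _ ht0 (hM M le_rfl) hPM
  rw [Path.subpath_zero_one] at hPM
  exact null_of_toLoop_cast a b γ γ.source γ.target hPM

/-! ### Part 4: filling a finite connected subset of the triangular lattice -/

/-- a lattice step outside `V` -/
def outS (V : Set (ℤ × ℤ)) (a b : ℤ × ℤ) : Prop := hadj a b ∧ a ∉ V ∧ b ∉ V

/-- points of the exterior of `V` -/
def HExt (V : Set (ℤ × ℤ)) (M : ℤ) : Set (ℤ × ℤ) :=
  {q | ∃ q', Relation.ReflTransGen (outS V) q q' ∧ M ≤ q'.2}

/-- hadj-connectedness -/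
def HConn (V : Set (ℤ × ℤ)) : Prop := ∀ p ∈ V, ∀ q ∈ V,
  Relation.ReflTransGen (fun a b => hadj a b ∧ a ∈ V ∧ b ∈ V) p q

lemma ext_not_mem {V : Set (ℤ × ℤ)} {M : ℤ} (hM : ∀ v ∈ V, v.2 < M) {q : ℤ × ℤ}
    (hq : q ∈ HExt V M) : q ∉ V := by
  obtain ⟨q', h, hq'⟩ := hq
  intro hv
  rcases Relation.ReflTransGen.cases_head h with h | ⟨c, h, _⟩
  · subst h
    exact absurd hq' (not_le.2 (hM _ hv))
  · exact h.2.1 hv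

lemma ext_chain {V : Set (ℤ × ℤ)} {M : ℤ} {q e : ℤ × ℤ}
    (h : Relation.ReflTransGen (outS V) q e) (he : e ∈ HExt V M) : q ∈ HExt V M := by
  obtain ⟨q', h', hq'⟩ := he
  exact ⟨q', h.trans h', hq'⟩

lemma ext_step {V : Set (ℤ × ℤ)} {M : ℤ} (hM : ∀ v ∈ V, v.2 < M) {q e : ℤ × ℤ}
    (h : hadj q e) (hq : q ∉ V) (he : e ∈ HExt V M) : q ∈ HExt V M :=
  ext_chain (Relation.ReflTransGen.single ⟨h, hq, ext_not_mem hM he⟩) he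

lemma chain_up (V : Set (ℤ × ℤ)) (x y : ℤ) (n : ℕ) (h : ∀ k : ℕ, k ≤ n → (x, y + (k:ℤ)) ∉ V) :
    Relation.ReflTransGen (outS V) (x, y) (x, y + (n : ℤ)) := by
  induction n with
  | zero => simpa using Relation.ReflTransGen.refl
  | succ n ih =>
    refine (ih fun k hk => h k (by omega)).tail ⟨?_, h n (by omega), ?_⟩
    · unfold hadj; push_cast; omega
    · exact h (n + 1) le_rfl

lemma chain_right (V : Set (ℤ × ℤ)) (x y : ℤ) (n : ℕ) (h : ∀ k : ℕ, k ≤ n → (x + (k:ℤ), y) ∉ V) :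
    Relation.ReflTransGen (outS V) (x, y) (x + (n : ℤ), y) := by
  induction n with
  | zero => simpa using Relation.ReflTransGen.refl
  | succ n ih =>
    refine (ih fun k hk => h k (by omega)).tail ⟨?_, h n (by omega), ?_⟩
    · unfold hadj; push_cast; omega
    · exact h (n + 1) le_rfl

lemma ext_of_column {V : Set (ℤ × ℤ)} {M : ℤ} {q : ℤ × ℤ}
    (h : ∀ v ∈ V, v.1 = q.1 → v.2 < q.2) : q ∈ HExt V M := by
  refine ⟨_, chain_up V q.1 q.2 (M - q.2).toNat ?_, ?_⟩
  · intro k _ hk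
    have := h _ hk rfl
    simp only at this
    omega
  · simp only; omega

lemma fill_lower {V : Set (ℤ × ℤ)} {M m X : ℤ} (hm : ∀ v ∈ V, m ≤ v.2) (hX : ∀ v ∈ V, v.1 ≤ X) :
    ∀ w ∈ (HExt V M)ᶜ, m ≤ w.2 := by
  intro w hw
  by_contra hlt
  push Not at hlt
  apply hw
  refine ext_chain (chain_right V w.1 w.2 (X + 1 - w.1).toNat ?_) (ext_of_column ?_)
  · intro k _ hk
    have := hm _ hk
    simp only at this
    omega
  · intro v hv hv'
    have := hX v hv
    simp only at hv'
    omega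

lemma fill_upper {V : Set (ℤ × ℤ)} {M b : ℤ} (hm : ∀ v ∈ V, v.2 ≤ b) :
    ∀ w ∈ (HExt V M)ᶜ, w.2 ≤ b := by
  intro w hw
  by_contra hlt
  push Not at hlt
  apply hw
  apply ext_of_column
  intro v hv _
  have := hm v hv
  omega

lemma fill_sup {V : Set (ℤ × ℤ)} {M : ℤ} (hM : ∀ v ∈ V, v.2 < M) : V ⊆ (HExt V M)ᶜ :=
  fun _ hv hq => ext_not_mem hM hq hv

lemma fill_full {V : Set (ℤ × ℤ)} {M : ℤ} : Full (HExt V M)ᶜ := by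
  intro q hq
  rw [notMem_compl_iff] at hq
  obtain ⟨q', h, hq'⟩ := hq
  refine ⟨q', ?_, ?_⟩
  · induction h using Relation.ReflTransGen.head_induction_on with
    | refl => exact .refl
    | head h h' ih =>
      refine Relation.ReflTransGen.head ⟨h.1, ?_, ?_⟩ ih
      · rw [notMem_compl_iff]
        exact ⟨q', Relation.ReflTransGen.head h h', hq'⟩
      · rw [notMem_compl_iff]
        exact ⟨q', h', hq'⟩
  · intro w hw
    by_contra hlt
    push Not at hlt
    exact hw ⟨w, .refl, by omega⟩

open Classical in
/-- first hit of the column above `w` with `A` -/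
lemma first_hit {A : Set (ℤ × ℤ)} {w : ℤ × ℤ} (h : ∃ k : ℕ, (w.1, w.2 + (k:ℤ)) ∈ A) :
    ∃ k : ℕ, (w.1, w.2 + (k:ℤ)) ∈ A ∧ ∀ j : ℕ, j < k → (w.1, w.2 + (j:ℤ)) ∉ A :=
  ⟨Nat.find h, Nat.find_spec h, fun _ hj => Nat.find_min h hj⟩

lemma hit_of_fill {V : Set (ℤ × ℤ)} {M : ℤ} {w : ℤ × ℤ} (hw : w ∈ (HExt V M)ᶜ) :
    ∃ k : ℕ, (w.1, w.2 + (k:ℤ)) ∈ V := by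
  by_contra hcon
  push Not at hcon
  refine hw ⟨_, chain_up V w.1 w.2 (M - w.2).toNat (fun k _ => hcon k), ?_⟩
  simp only; omega

lemma fill_to {V : Set (ℤ × ℤ)} {M : ℤ} (hM : ∀ v ∈ V, v.2 < M) {w : ℤ × ℤ}
    (hw : w ∈ (HExt V M)ᶜ) :
    ∃ v ∈ V, Relation.ReflTransGen
      (fun a b => hadj a b ∧ a ∈ (HExt V M)ᶜ ∧ b ∈ (HExt V M)ᶜ) w v := by
  obtain ⟨k, hk, hk'⟩ := first_hit (hit_of_fill hw)
  refine ⟨_, hk, ?_⟩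
  have hin : ∀ j : ℕ, j ≤ k → (w.1, w.2 + (j:ℤ)) ∈ (HExt V M)ᶜ := by
    intro j hj
    rcases hj.lt_or_eq with hj | rfl
    · intro he
      exact hw (ext_chain (chain_up V w.1 w.2 j fun i hi => hk' i (by omega)) he)
    · exact fill_sup hM hk
  have : ∀ j : ℕ, j ≤ k → Relation.ReflTransGen
      (fun a b => hadj a b ∧ a ∈ (HExt V M)ᶜ ∧ b ∈ (HExt V M)ᶜ) w (w.1, w.2 + (j:ℤ)) := by
    intro j
    induction j with
    | zero => intro _; simpa using Relation.ReflTransGen.refl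
    | succ n ih =>
      intro hn
      refine (ih (by omega)).tail ⟨?_, hin n (by omega), ?_⟩
      · unfold hadj; push_cast; omega
      · exact hin (n + 1) hn
  exact this k le_rfl

lemma fill_conn {V : Set (ℤ × ℤ)} {M : ℤ} (hM : ∀ v ∈ V, v.2 < M) (hV : HConn V) :
    HConn (HExt V M)ᶜ := by
  intro p hp q hq
  obtain ⟨v, hv, h1⟩ := fill_to hM hp
  obtain ⟨v', hv', h2⟩ := fill_to hM hq
  have h3 : Relation.ReflTransGen
      (fun a b => hadj a b ∧ a ∈ (HExt V M)ᶜ ∧ b ∈ (HExt V M)ᶜ) v v' := by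
    refine Relation.ReflTransGen.mono ?_ _ _ (hV v hv v' hv')
    rintro a b ⟨h, ha, hb⟩
    exact ⟨h, fill_sup hM ha, fill_sup hM hb⟩
  have : Std.Symm (fun a b => hadj a b ∧ a ∈ (HExt V M)ᶜ ∧ b ∈ (HExt V M)ᶜ) :=
    ⟨fun a b h => ⟨hadj_symm h.1, h.2.2, h.2.1⟩⟩
  exact (h1.trans h3).trans (Relation.ReflTransGen.stdSymm.symm _ _ h2)

lemma sub_ext {V V' : Set (ℤ × ℤ)} {M : ℤ} (hM : ∀ v ∈ V, v.2 < M) (hV' : HConn V')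
    (hna : ∀ a ∈ V, ∀ b ∈ V', ¬ hadj a b) (hcol : ∃ v ∈ V', ∀ w ∈ V, w.1 ≠ v.1) :
    V' ⊆ HExt V M := by
  obtain ⟨v, hv, hcol⟩ := hcol
  intro q hq
  have := hV' q hq v hv
  induction this using Relation.ReflTransGen.head_induction_on with
  | refl => exact ext_of_column fun w hw h => absurd h (hcol w hw)
  | head h h' ih =>
    exact ext_step hM h.1 (fun hc => hna _ hc _ h.2.1 (hadj_refl _)) (ih h.2.2)

lemma fill_disj_aux {V V' : Set (ℤ × ℤ)} {M : ℤ}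
    (hna : ∀ a ∈ V, ∀ b ∈ V', ¬ hadj a b) (h2 : V ⊆ HExt V' M) {w : ℤ × ℤ} {k : ℕ}
    (hk : (w.1, w.2 + (k:ℤ)) ∈ V) (hk' : ∀ j : ℕ, j < k → (w.1, w.2 + (j:ℤ)) ∉ V ∪ V') :
    w ∈ HExt V' M := by
  refine ext_chain (chain_up V' w.1 w.2 k ?_) (h2 hk)
  intro j hj hjV
  rcases hj.lt_or_eq with hj | rfl
  · exact hk' j hj (Or.inr hjV)
  · exact hna _ hk _ hjV (hadj_refl _)

lemma fill_nonadj {V V' : Set (ℤ × ℤ)} {M : ℤ} (hM : ∀ v ∈ V, v.2 < M) (hM' : ∀ v ∈ V', v.2 < M)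
    (hV : HConn V) (hV' : HConn V')
    (hna : ∀ a ∈ V, ∀ b ∈ V', ¬ hadj a b) (hcol : ∃ v ∈ V', ∀ w ∈ V, w.1 ≠ v.1)
    (hcol' : ∃ v ∈ V, ∀ w ∈ V', w.1 ≠ v.1) :
    ∀ a ∈ (HExt V M)ᶜ, ∀ b ∈ (HExt V' M)ᶜ, ¬ hadj a b := by
  have hna' : ∀ a ∈ V', ∀ b ∈ V, ¬ hadj a b := fun a ha b hb h => hna b hb a ha (hadj_symm h)
  have h1 := sub_ext hM hV' hna hcol
  have h2 := sub_ext hM' hV hna' hcol'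
  intro w hw w' hw' hadj'
  by_cases hc : w ∈ HExt V' M
  · by_cases hwV : w' ∈ V'
    · by_cases hv : w ∈ V
      · exact hna _ hv _ hwV hadj'
      · exact hw (ext_step hM hadj' hv (h1 hwV))
    · exact hw' (ext_step hM' (hadj_symm hadj') hwV hc)
  · obtain ⟨k, hk, hk'⟩ := first_hit (A := V ∪ V') (w := w) (by
      obtain ⟨k, hk⟩ := hit_of_fill hw
      exact ⟨k, Or.inl hk⟩)
    rcases hk with hk | hk
    · exact hc (fill_disj_aux hna h2 hk hk')
    · exact hw (fill_disj_aux hna' h1 hk (by rwa [union_comm]))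

/-- horizontal translate -/
def hsh (c : ℤ) (V : Set (ℤ × ℤ)) : Set (ℤ × ℤ) := {p | (p.1 - c, p.2) ∈ V}

lemma hadj_sh {a b : ℤ × ℤ} (c : ℤ) (h : hadj a b) : hadj (a.1 + c, a.2) (b.1 + c, b.2) := by
  unfold hadj at *; simp only; omega

lemma hsh_chain (c : ℤ) (V : Set (ℤ × ℤ)) {a b : ℤ × ℤ} (h : Relation.ReflTransGen (outS V) a b) :
    Relation.ReflTransGen (outS (hsh c V)) (a.1 + c, a.2) (b.1 + c, b.2) := by
  refine Relation.ReflTransGen.lift (fun a : ℤ × ℤ => (a.1 + c, a.2)) ?_ _ _ h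
  intro a b h
  exact ⟨hadj_sh c h.1, by simpa [hsh] using h.2.1, by simpa [hsh] using h.2.2⟩

lemma hsh_conn (c : ℤ) {V : Set (ℤ × ℤ)} (hV : HConn V) : HConn (hsh c V) := by
  intro p hp q hq
  have := hV _ hp _ hq
  have := Relation.ReflTransGen.lift (p := fun a b => hadj a b ∧ a ∈ hsh c V ∧ b ∈ hsh c V)
    (fun a : ℤ × ℤ => (a.1 + c, a.2)) (by
      intro a b h
      exact ⟨hadj_sh c h.1, by simpa [hsh] using h.2.1, by simpa [hsh] using h.2.2⟩) _ _ this
  simpa [Function.onFun] using this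

lemma hsh_ext (c : ℤ) (V : Set (ℤ × ℤ)) (M : ℤ) {q : ℤ × ℤ} (h : (q.1 + c, q.2) ∈ HExt (hsh c V) M) :
    q ∈ HExt V M := by
  obtain ⟨q', h, hq'⟩ := h
  have := hsh_chain (-c) _ h
  have e : hsh (-c) (hsh c V) = V := by
    ext p; simp [hsh]
  rw [e] at this
  refine ⟨(q'.1 + -c, q'.2), by simpa using this, hq'⟩

/-- The filled set. -/
theorem exists_fill (V : Set (ℤ × ℤ)) (hne : V.Nonempty) (hV : HConn V) (X m b T : ℤ)
    (hX : ∀ v ∈ V, |v.1| ≤ X) (hm : ∀ v ∈ V, m ≤ v.2) (hb : ∀ v ∈ V, v.2 ≤ b) (hT : 0 < T)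
    (hna : ∀ k : ℤ, k ≠ 0 → ∀ p ∈ V, ∀ q ∈ V, ¬ hadj p (q.1 + k * T, q.2)) :
    ∃ W : Set (ℤ × ℤ), V ⊆ W ∧ HConn W ∧ Full W ∧ (∀ w ∈ W, m ≤ w.2) ∧ (∀ w ∈ W, w.2 ≤ b) ∧
      ∀ k : ℤ, k ≠ 0 → ∀ p ∈ W, ∀ q ∈ W, ¬ hadj p (q.1 + k * T, q.2) := by
  have hM : ∀ v ∈ V, v.2 < b + 1 := fun v hv => by have := hb v hv; omega
  obtain ⟨v1, hv1, hmax⟩ : ∃ v ∈ V, ∀ w ∈ V, w.1 ≤ v.1 := by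
    obtain ⟨x, ⟨⟨v, hv, rfl⟩, h⟩⟩ := Int.exists_greatest_of_bdd (P := fun x => ∃ v ∈ V, v.1 = x)
      ⟨X, by rintro _ ⟨v, hv, rfl⟩; exact (abs_le.1 (hX v hv)).2⟩ ⟨_, hne.some, hne.some_mem, rfl⟩
    exact ⟨v, hv, fun w hw => h _ ⟨w, hw, rfl⟩⟩
  obtain ⟨v0, hv0, hmin⟩ : ∃ v ∈ V, ∀ w ∈ V, v.1 ≤ w.1 := by
    obtain ⟨x, ⟨⟨v, hv, rfl⟩, h⟩⟩ := Int.exists_least_of_bdd (P := fun x => ∃ v ∈ V, v.1 = x)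
      ⟨-X, by rintro _ ⟨v, hv, rfl⟩; exact (abs_le.1 (hX v hv)).1⟩ ⟨_, hne.some, hne.some_mem, rfl⟩
    exact ⟨v, hv, fun w hw => h _ ⟨w, hw, rfl⟩⟩
  refine ⟨(HExt V (b + 1))ᶜ, fill_sup hM, fill_conn hM hV, fill_full,
    fill_lower hm fun v hv => (abs_le.1 (hX v hv)).2, fill_upper hb, ?_⟩
  intro k hk p hp q hq
  have hmem : ∀ v ∈ V, (v.1 + k * T, v.2) ∈ hsh (k * T) V := fun v hv => by simpa [hsh] using hv
  refine fill_nonadj (V' := hsh (k * T) V) hM (fun v hv => hM (v.1 - k * T, v.2) hv) hV (hsh_conn _ hV) ?_ ?_ ?_ p hp _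
    (fun h => hq (hsh_ext _ _ _ h))
  · intro a ha b' hb' h
    refine hna k hk a ha _ hb' ?_
    simpa using h
  · rcases lt_or_gt_of_ne hk with hk | hk
    · refine ⟨_, hmem v0 hv0, fun w hw => ?_⟩
      have := hmin w hw
      have : k * T < 0 := by nlinarith
      simp only; omega
    · refine ⟨_, hmem v1 hv1, fun w hw => ?_⟩
      have := hmax w hw
      have : k * T > 0 := by positivity
      simp only; omega
  · rcases lt_or_gt_of_ne hk with hk | hk
    · refine ⟨_, hv1, fun w hw => ?_⟩
      have := hmax _ hw
      have : k * T < 0 := by nlinarith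
      simp only at *; omega
    · refine ⟨_, hv0, fun w hw => ?_⟩
      have := hmin _ hw
      have : k * T > 0 := by positivity
      simp only at *; omega

/-! ### Part 5: a simply connected neighbourhood -/

lemma mem_hball_floor (x y : ℝ) : ((x, y) : ℝ × ℝ) ∈ hball (⌊x⌋, ⌊y⌋) := by
  have h1 := Int.floor_le x
  have h2 := Int.lt_floor_add_one x
  have h3 := Int.floor_le y
  have h4 := Int.lt_floor_add_one y
  refine ⟨abs_lt.2 ⟨?_, ?_⟩, abs_lt.2 ⟨?_, ?_⟩, abs_lt.2 ⟨?_, ?_⟩⟩ <;> simp only <;> linarith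

/-- the lattice points seen by `K₀` -/
def seen (N : ℕ) (K₀ : Set AnnTil) : Set (ℤ × ℤ) :=
  {p | ∃ z ∈ K₀, ((N * z.1, N * (z.2 : ℝ)) : ℝ × ℝ) ∈ hball p}

lemma seen_conn (N : ℕ) (K₀ : Set AnnTil) (hK : IsConnected K₀) : HConn (seen N K₀) := by
  intro p hp q hq
  by_contra hcon
  set R := Relation.ReflTransGen (fun a b => hadj a b ∧ a ∈ seen N K₀ ∧ b ∈ seen N K₀) with hR
  let A : Set AnnTil := ⋃ r ∈ {r | r ∈ seen N K₀ ∧ R p r},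
    (fun z : AnnTil => ((N * z.1, N * (z.2 : ℝ)) : ℝ × ℝ)) ⁻¹' hball r
  let B : Set AnnTil := ⋃ r ∈ {r | r ∈ seen N K₀ ∧ ¬ R p r},
    (fun z : AnnTil => ((N * z.1, N * (z.2 : ℝ)) : ℝ × ℝ)) ⁻¹' hball r
  have hA : IsOpen A := isOpen_biUnion fun r _ => (hball_open r).preimage (by fun_prop)
  have hB : IsOpen B := isOpen_biUnion fun r _ => (hball_open r).preimage (by fun_prop)
  obtain ⟨z, hz, hzA, hzB⟩ := hK.isPreconnected A B hA hB (by
      intro z hz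
      have hs : (⌊N * z.1⌋, ⌊N * (z.2 : ℝ)⌋) ∈ seen N K₀ := ⟨z, hz, mem_hball_floor _ _⟩
      by_cases h : R p (⌊N * z.1⌋, ⌊N * (z.2 : ℝ)⌋)
      · exact Or.inl (mem_biUnion (show _ ∈ {r | r ∈ seen N K₀ ∧ R p r} from ⟨hs, h⟩)
          (mem_hball_floor _ _))
      · exact Or.inr (mem_biUnion (show _ ∈ {r | r ∈ seen N K₀ ∧ ¬ R p r} from ⟨hs, h⟩)
          (mem_hball_floor _ _)))
    (by
      obtain ⟨z, hz, h⟩ := id hp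
      exact ⟨z, hz, mem_biUnion (show _ ∈ {r | r ∈ seen N K₀ ∧ R p r} from
        ⟨hp, Relation.ReflTransGen.refl⟩) h⟩)
    (by
      obtain ⟨z, hz, h⟩ := id hq
      exact ⟨z, hz, mem_biUnion (show _ ∈ {r | r ∈ seen N K₀ ∧ ¬ R p r} from
        ⟨hq, hcon⟩) h⟩)
  obtain ⟨r, hr, hzr⟩ := mem_iUnion₂.1 hzA
  obtain ⟨s, hs, hzs⟩ := mem_iUnion₂.1 hzB
  exact hs.2 (Relation.ReflTransGen.tail hr.2 ⟨hadj_of_mem hzr hzs, hr.1, hs.1⟩)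

lemma pr_open : IsOpenMap pr := by
  have h1 : IsOpenMap (fun x : ℝ => Circle.exp (2 * Real.pi * x)) := by
    have : IsOpenMap (fun x : ℝ => 2 * Real.pi * x) :=
      (Homeomorph.mulLeft₀ (2 * Real.pi) (by positivity)).isOpenMap
    exact (isLocalHomeomorph_circleExp.isOpenMap).comp this
  exact h1.prodMap IsOpenMap.id

lemma pr_cont : Continuous pr := by
  unfold pr; fun_prop

lemma pr_eq {z z' : AnnTil} (h : pr z = pr z') : ∃ k : ℤ, z = tr z' k := by
  have h1 := congrArg Prod.fst h
  have h2 : (pr z).2 = (pr z').2 := congrArg Prod.snd h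
  obtain ⟨m, hm⟩ := Circle.exp_eq_exp.1 h1
  refine ⟨m, Prod.ext ?_ h2⟩
  simp only [tr]
  have : (2 * Real.pi) * (z.1 - (z'.1 + m)) = 0 := by linarith
  have := (mul_eq_zero.1 this).resolve_left (by positivity)
  linarith

lemma pr_tr (z : AnnTil) (k : ℤ) : pr (tr z k) = pr z := by
  refine Prod.ext ?_ rfl
  exact Circle.exp_eq_exp.2 ⟨k, by simp only [tr]; ring⟩

lemma hball_shift {x y : ℝ} {q : ℤ × ℤ} (c : ℤ) (h : ((x, y) : ℝ × ℝ) ∈ hball q) :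
    ((x + c, y) : ℝ × ℝ) ∈ hball (q.1 + c, q.2) := by
  obtain ⟨h1, h2, h3⟩ := h
  refine ⟨?_, h2, ?_⟩
  · convert h1 using 2; push_cast; ring
  · convert h3 using 2; push_cast; ring

theorem exists_nbhd (W : Set (ℤ × ℤ)) (N : ℕ) (hN : 0 < N) (hne : W.Nonempty) (hWc : HConn W)
    (hWf : Full W) (hm : ∀ w ∈ W, 1 ≤ w.2) (hb : ∀ w ∈ W, w.2 ≤ N - 1)
    (hna : ∀ k : ℤ, k ≠ 0 → ∀ p ∈ W, ∀ q ∈ W, ¬ hadj p (q.1 + k * N, q.2)) :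
    ∃ U : Set Ann, IsOpen U ∧ IsConnected U ∧ SimplyConnectedSpace U ∧
      ∀ z : AnnTil, ∀ p ∈ W, ((N * z.1, N * (z.2 : ℝ)) : ℝ × ℝ) ∈ hball p → pr z ∈ U := by
  have hN' : (0:ℝ) < N := by exact_mod_cast hN
  let j : AnnTil → ℝ × ℝ := fun z => (N * z.1, N * (z.2 : ℝ))
  have hj : Continuous j := by fun_prop
  let S : Set AnnTil := j ⁻¹' hU W
  have hS : IsOpen S := (hU_open W).preimage hj
  have hran : ∀ z ∈ hU W, z.2 / N ∈ Ioo (0:ℝ) 1 := by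
    intro z hz
    simp only [hU, mem_iUnion] at hz
    obtain ⟨p, hp, h1, h2, h3⟩ := hz
    have e1 : (1:ℝ) ≤ p.2 := by exact_mod_cast hm p hp
    have e2 : (p.2:ℝ) ≤ N - 1 := by exact_mod_cast hb p hp
    rw [abs_lt] at h2
    constructor
    · apply div_pos _ hN'; linarith
    · rw [div_lt_one hN']; linarith
  let e : hU W ≃ₜ S :=
    { toFun := fun z => ⟨(z.1.1 / N, ⟨z.1.2 / N, hran z.1 z.2⟩), by
        have : j (z.1.1 / N, ⟨z.1.2 / N, hran z.1 z.2⟩) = z.1 := by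
          refine Prod.ext ?_ ?_ <;> simp only [j] <;> field_simp
        change j _ ∈ hU W
        rw [this]; exact z.2⟩
      invFun := fun z => ⟨j z.1, z.2⟩
      left_inv := by
        intro z
        apply Subtype.ext
        refine Prod.ext ?_ ?_ <;> simp only [j] <;> field_simp
      right_inv := by
        intro z
        apply Subtype.ext
        refine Prod.ext ?_ (Subtype.ext ?_) <;> simp only [j] <;> field_simp
      continuous_toFun := by fun_prop
      continuous_invFun := by fun_prop }
  have hinj : Function.Injective (fun z : S => pr z.1) := by
    intro z z' h
    obtain ⟨k, hk⟩ := pr_eq h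
    have h1 : j z.1 ∈ hU W := z.2
    have h2 : j z'.1 ∈ hU W := z'.2
    simp only [hU, mem_iUnion] at h1 h2
    obtain ⟨p, hp, hpz⟩ := h1
    obtain ⟨q, hq, hqz⟩ := h2
    by_cases hk0 : k = 0
    · apply Subtype.ext
      rw [hk, hk0]
      simp [tr]
    · exfalso
      refine hna k hk0 p hp q hq (hadj_of_mem hpz ?_)
      have := hball_shift (k * N) hqz
      convert this using 2
      · rw [hk]; simp only [tr]; push_cast; ring
      · rw [hk]; rfl
  have hemb : IsOpenEmbedding (fun z : S => pr z.1) :=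
    .of_continuous_injective_isOpenMap (pr_cont.comp continuous_subtype_val) hinj
      (pr_open.comp hS.isOpenMap_subtype_val)
  have hsc : SimplyConnectedSpace (hU W) := hU_simplyConnected W hne hWc hWf 1 hm
  have e2 := e.trans hemb.isEmbedding.toHomeomorph
  have hsc2 : SimplyConnectedSpace (range (fun z : S => pr z.1)) :=
    (ContinuousMap.HomotopyEquiv.simplyConnectedSpace_iff e2.toHomotopyEquiv).1 hsc
  refine ⟨range (fun z : S => pr z.1), hemb.isOpen_range, ?_, hsc2, ?_⟩
  · exact isConnected_iff_connectedSpace.2 inferInstance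
  · intro z p hp hz
    exact ⟨⟨z, hball_sub hp hz⟩, rfl⟩

set_option maxHeartbeats 1000000 in
theorem not_essential (K : Set Ann) (K₀ : Set AnnTil) (hc : IsCompact K₀) (hconn : IsConnected K₀)
    (hsub : K ⊆ pr '' K₀) (δ : ℝ) (hδ : 0 < δ)
    (hsep : ∀ k : ℤ, k ≠ 0 → ∀ z ∈ K₀, ∀ z' ∈ K₀, δ ≤ dist z (tr z' k)) : ¬ IsEssential K := by
  obtain ⟨R, hR⟩ : ∃ R, ∀ z ∈ K₀, |z.1| ≤ R := by
    obtain ⟨R, hR⟩ := hc.exists_bound_of_continuousOn (f := fun z : AnnTil => z.1)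
      continuous_fst.continuousOn
    exact ⟨R, fun z hz => hR z hz⟩
  obtain ⟨za, hza, ha⟩ := hc.exists_isMinOn hconn.nonempty (f := fun z : AnnTil => (z.2 : ℝ))
    (by fun_prop)
  obtain ⟨zb, hzb, hb⟩ := hc.exists_isMaxOn hconn.nonempty (f := fun z : AnnTil => (z.2 : ℝ))
    (by fun_prop)
  have ha0 := za.2.2.1
  have hb1 := zb.2.2.2
  obtain ⟨N1, h1⟩ := exists_nat_gt (1 / (za.2 : ℝ))
  obtain ⟨N2, h2⟩ := exists_nat_gt (1 / (1 - (zb.2 : ℝ)))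
  obtain ⟨N3, h3⟩ := exists_nat_gt (3 / δ)
  rw [div_lt_iff₀ ha0] at h1
  rw [div_lt_iff₀ (by linarith)] at h2
  rw [div_lt_iff₀ hδ] at h3
  set N := N1 + N2 + N3 + 1 with hN
  have hNpos : 0 < N := by omega
  have hNr : (N:ℝ) = N1 + N2 + N3 + 1 := by rw [hN]; push_cast; ring
  have p1 : (0:ℝ) ≤ N1 := Nat.cast_nonneg _
  have p2 : (0:ℝ) ≤ N2 := Nat.cast_nonneg _
  have p3 : (0:ℝ) ≤ N3 := Nat.cast_nonneg _
  have q1 : 1 < N * (za.2 : ℝ) := by rw [hNr]; nlinarith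
  have q2 : 1 < N * (1 - (zb.2 : ℝ)) := by rw [hNr]; nlinarith
  have q3 : 3 < N * δ := by rw [hNr]; nlinarith
  have hNp : (0:ℝ) < N := by positivity
  clear_value N
  obtain ⟨W, hVW, hWc, hWf, hWm, hWb, hWna⟩ := exists_fill (seen N K₀) (by
      obtain ⟨z, hz⟩ := hconn.nonempty
      exact ⟨_, z, hz, mem_hball_floor _ _⟩) (seen_conn N K₀ hconn) ⌈N * R + 1⌉ 1 (N - 1) N (by
      rintro v ⟨z, hz, h, _, _⟩
      have := hR z hz
      have : |(v.1 : ℝ)| ≤ N * R + 1 := by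
        rw [abs_lt] at h; simp only at h
        rw [abs_le] at this ⊢
        constructor <;> nlinarith
      have h' := this.trans (Int.le_ceil _)
      exact_mod_cast h') (by
      rintro v ⟨z, hz, _, h, _⟩
      have hh : (za.2 : ℝ) ≤ z.2 := ha hz
      rw [abs_lt] at h; simp only at h
      have : (0:ℝ) < v.2 := by nlinarith
      have : 0 < v.2 := by exact_mod_cast this
      omega) (by
      rintro v ⟨z, hz, _, h, _⟩
      have hh : (z.2 : ℝ) ≤ zb.2 := hb hz
      rw [abs_lt] at h; simp only at h
      have : (v.2:ℝ) < N := by nlinarith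
      have : v.2 < N := by exact_mod_cast this
      omega) (by exact_mod_cast hNpos) (by
      rintro k hk p ⟨z, hz, a1, a2, _⟩ q ⟨z', hz', b1, b2, _⟩ had
      have hs := hsep k hk z hz z' hz'
      rw [Prod.dist_eq, le_max_iff] at hs
      obtain ⟨c1, c2, c3, c4, _, _⟩ := had
      simp only at c1 c2 c3 c4 a1 a2 b1 b2
      rw [abs_lt] at a1 a2 b1 b2
      have c1' : (p.1:ℝ) - (q.1 + k * N) ≤ 1 := by exact_mod_cast c1
      have c2' : (q.1 + k * N : ℝ) - p.1 ≤ 1 := by exact_mod_cast c2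
      have c3' : (p.2:ℝ) - q.2 ≤ 1 := by exact_mod_cast c3
      have c4' : (q.2:ℝ) - p.2 ≤ 1 := by exact_mod_cast c4
      rcases hs with hs | hs
      · rw [Real.dist_eq] at hs
        simp only [tr] at hs
        rcases le_abs.1 hs with hs | hs <;> have hs' := mul_le_mul_of_nonneg_left hs hNp.le <;> linarith
      · rw [Subtype.dist_eq, Real.dist_eq] at hs
        simp only [tr] at hs
        rcases le_abs.1 hs with hs | hs <;> have hs' := mul_le_mul_of_nonneg_left hs hNp.le <;> linarith)
  obtain ⟨U, hUo, hUc, hUs, hUm⟩ := exists_nbhd W N hNpos (by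
      obtain ⟨z, hz⟩ := hconn.nonempty
      exact ⟨_, hVW ⟨z, hz, mem_hball_floor _ _⟩⟩) hWc hWf hWm hWb hWna
  intro hess
  refine hess ⟨U, hUo, hUc, hUs, fun x hx => ?_⟩
  obtain ⟨z, hz, rfl⟩ := hsub hx
  exact hUm z _ (hVW ⟨z, hz, mem_hball_floor _ _⟩) (mem_hball_floor _ _)

/-! ### Part 6: the semiconjugacy -/

lemma tr_zero (z : AnnTil) : tr z 0 = z := by simp [tr]

lemma tr_tr (z : AnnTil) (a b : ℤ) : tr (tr z a) b = tr z (a + b) := by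
  refine Prod.ext ?_ rfl
  simp only [tr]; push_cast; ring

lemma tr_mem {K : Set Ann} {z : AnnTil} (hz : z ∈ pr ⁻¹' K) (k : ℤ) : tr z k ∈ pr ⁻¹' K := by
  rw [mem_preimage, pr_tr]; exact hz

lemma slab_compact {K : Set Ann} (hK : IsCompact K) (a b : ℝ) :
    IsCompact ((Icc a b) ×ˢ (Prod.snd '' K) : Set AnnTil) :=
  isCompact_Icc.prod (hK.image continuous_snd)

lemma H_tr {K : Set Ann} {H : AnnTil → ℝ} (h : ∀ z ∈ pr ⁻¹' K, H (tr z 1) = H z + 1)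
    (z : AnnTil) (hz : z ∈ pr ⁻¹' K) (k : ℤ) : H (tr z k) = H z + k := by
  induction k with
  | zero => simp [tr_zero]
  | succ n ih =>
    rw [← tr_tr, h _ (tr_mem hz _), ih]; push_cast; ring
  | pred n ih =>
    have := h _ (tr_mem hz (-(n:ℤ) - 1))
    rw [tr_tr, sub_add_cancel, ih] at this
    push_cast at this ⊢; linarith

lemma F_tr {F : AnnTil → AnnTil} {d : ℤ} (h : ∀ z : AnnTil, F (tr z 1) = tr (F z) d)
    (z : AnnTil) (k : ℤ) : F (tr z k) = tr (F z) (d * k) := by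
  induction k with
  | zero => simp [tr_zero]
  | succ n ih =>
    rw [← tr_tr, h, ih, tr_tr]; congr 1; ring
  | pred n ih =>
    have := h (tr z (-(n:ℤ) - 1))
    rw [tr_tr, sub_add_cancel, ih] at this
    have := congrArg (fun w => tr w (-d)) this
    simp only [tr_tr] at this
    rw [add_neg_cancel, tr_zero] at this
    rw [← this]; congr 1; ring

lemma pr_surj : Function.Surjective pr := by
  intro x
  refine ⟨(Circle.argEquiv x.1 / (2 * Real.pi), x.2), Prod.ext ?_ rfl⟩
  simp only [pr]
  rw [mul_div_cancel₀ _ (by positivity)]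
  exact Circle.argEquiv.symm_apply_apply x.1

theorem H_surj (K : Set Ann) (hKc : IsCompact K) (hKconn : IsConnected K) (hKe : IsEssential K)
    (H : AnnTil → ℝ) (hH : ContinuousOn H (pr ⁻¹' K))
    (h1 : ∀ z ∈ pr ⁻¹' K, H (tr z 1) = H z + 1) (C : ℝ)
    (hC : ∀ z ∈ pr ⁻¹' K, |H z - z.1| ≤ C) (r : ℝ) : ∃ z ∈ pr ⁻¹' K, H z = r := by
  by_contra hcon
  push Not at hcon
  have hcl : IsClosed (pr ⁻¹' K) := hKc.isClosed.preimage pr_cont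
  have hne : ∀ z ∈ pr ⁻¹' K, ∀ k : ℤ, H z ≠ r + k := by
    intro z hz k h
    apply hcon _ (tr_mem hz (-k))
    rw [H_tr h1 z hz, h]; push_cast; ring
  have hne1 : ∀ z ∈ pr ⁻¹' K, H z ≠ r + 1 := fun z hz => by simpa using hne z hz 1
  let K₀ : Set AnnTil := pr ⁻¹' K ∩ H ⁻¹' Icc r (r + 1)
  let S : Set AnnTil := pr ⁻¹' K ∩ H ⁻¹' (Iic r ∪ Ici (r + 1))
  have hK₀ : IsClosed K₀ := hH.preimage_isClosed_of_isClosed hcl isClosed_Icc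
  have hS : IsClosed S := hH.preimage_isClosed_of_isClosed hcl (isClosed_Iic.union isClosed_Ici)
  have hlt : ∀ z ∈ K₀, r < H z ∧ H z < r + 1 := fun z hz =>
    ⟨lt_of_le_of_ne hz.2.1 (hcon z hz.1).symm, lt_of_le_of_ne hz.2.2 (hne1 z hz.1)⟩
  have hcomp : IsCompact K₀ := by
    refine (slab_compact hKc (r - C) (r + 1 + C)).of_isClosed_subset hK₀ ?_
    intro z hz
    have := abs_le.1 (hC z hz.1)
    obtain ⟨hz1, h2, h3⟩ := hz
    exact ⟨⟨by linarith, by linarith⟩, ⟨pr z, hz1, rfl⟩⟩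
  have hsub : K ⊆ pr '' K₀ := by
    intro x hx
    obtain ⟨z, rfl⟩ := pr_surj x
    refine ⟨tr z (-⌊H z - r⌋), ⟨tr_mem hx _, ?_⟩, pr_tr _ _⟩
    rw [mem_preimage, H_tr h1 z hx]
    have e1 := Int.floor_le (H z - r)
    have e2 := Int.lt_floor_add_one (H z - r)
    push_cast
    constructor <;> linarith
  have hmove : ∀ k : ℤ, k ≠ 0 → ∀ z ∈ K₀, tr z k ∈ S := by
    intro k hk z hz
    refine ⟨tr_mem hz.1 k, ?_⟩
    rw [mem_preimage, H_tr h1 z hz.1]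
    have := hlt z hz
    rcases lt_or_gt_of_ne hk with hk | hk
    · left
      have : (k:ℝ) ≤ -1 := by exact_mod_cast (by omega : k ≤ -1)
      simp only [mem_Iic]; linarith
    · right
      have : (1:ℝ) ≤ k := by exact_mod_cast (by omega : 1 ≤ k)
      simp only [mem_Ici]; linarith
  have hdisj : Disjoint K₀ S := by
    rw [Set.disjoint_left]
    intro z hz hzS
    have := hlt z hz
    rcases hzS.2 with h | h
    · simp only [mem_Iic] at h; linarith
    · simp only [mem_Ici] at h; linarith
  have hconn : IsConnected K₀ := by
    constructor
    · obtain ⟨x, hx⟩ := hKconn.nonempty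
      obtain ⟨z, hz, _⟩ := hsub hx
      exact ⟨z, hz⟩
    · have : CompactSpace K₀ := isCompact_iff_compactSpace.1 hcomp
      have hg : Continuous (fun z : K₀ => pr z.1) := pr_cont.comp continuous_subtype_val
      have hinj : Function.Injective (fun z : K₀ => pr z.1) := by
        intro z z' h
        obtain ⟨k, hk⟩ := pr_eq h
        by_cases hk0 : k = 0
        · apply Subtype.ext
          rw [hk, hk0, tr_zero]
        · exact absurd (hk ▸ hmove k hk0 z'.1 z'.2) (Set.disjoint_left.1 hdisj z.2)
      have := hKconn.isPreconnected.preimage_of_isClosedMap hinj hg.isClosedMap (by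
        intro x hx
        obtain ⟨z, hz, h⟩ := hsub hx
        exact ⟨⟨z, hz⟩, h⟩)
      have h2 := this.image Subtype.val continuous_subtype_val.continuousOn
      convert h2 using 1
      ext z
      constructor
      · intro hz
        exact ⟨⟨z, hz⟩, hz.1, rfl⟩
      · rintro ⟨w, _, rfl⟩
        exact w.2
  obtain ⟨δ, hδ, hsep⟩ := Metric.exists_pos_forall_lt_edist hcomp hS hdisj
  refine not_essential K K₀ hcomp hconn hsub δ (by exact_mod_cast hδ) ?_ hKe
  intro k hk z hz z' hz'
  have := hsep z hz _ (hmove k hk z' hz')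
  rw [edist_nndist] at this
  have : δ < nndist z (tr z' k) := by exact_mod_cast this
  rw [dist_nndist]
  exact_mod_cast this.le

/-- For an essential invariant continuum, the map `H` of the semiconjugacy
lemma is surjective onto `ℝ`. -/
theorem stmt_15 (f : Ann → Ann) (d : ℤ) (hcov : IsCoveringMap f)
    (hdeg : HasDegree f d) (hd : 1 < |d|)
    (K : Set Ann) (hKc : IsCompact K) (hKconn : IsConnected K)
    (hKe : IsEssential K) (hKinv : f '' K ⊆ K)
    (F : AnnTil → AnnTil) (hF : IsLift f F)
    (hFdeg : ∀ z : AnnTil, F (tr z 1) = tr (F z) d) :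
    ∃ H : AnnTil → ℝ, ContinuousOn H (pr ⁻¹' K) ∧
      (∀ z ∈ pr ⁻¹' K, H (tr z 1) = H z + 1) ∧
      (∀ z ∈ pr ⁻¹' K, H (F z) = d * H z) ∧
      (∃ C : ℝ, ∀ z ∈ pr ⁻¹' K, |H z - z.1| ≤ C) ∧
      (∀ z ∈ pr ⁻¹' K, Filter.Tendsto
        (fun n : ℕ => (F^[n] z).1 / (d : ℝ) ^ n) Filter.atTop (nhds (H z))) ∧
      (∀ r : ℝ, ∃ z ∈ pr ⁻¹' K, H z = r) := by
  have hFc : Continuous F := hF.1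
  have hinv : ∀ z ∈ pr ⁻¹' K, F z ∈ pr ⁻¹' K := by
    intro z hz
    have : pr (F z) = f (pr z) := congrFun hF.2 z
    rw [mem_preimage, this]
    exact hKinv ⟨_, hz, rfl⟩
  have hinvn : ∀ n : ℕ, ∀ z ∈ pr ⁻¹' K, F^[n] z ∈ pr ⁻¹' K := by
    intro n
    induction n with
    | zero => exact fun z hz => hz
    | succ n ih =>
      intro z hz
      rw [Function.iterate_succ_apply]
      exact ih _ (hinv z hz)
  have hd1 : 1 < |(d:ℝ)| := by exact_mod_cast hd
  have hd0 : (d:ℝ) ≠ 0 := by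
    intro h; rw [h, abs_zero] at hd1; linarith
  let G : AnnTil → ℝ := fun z => (F z).1 - d * z.1
  have hG : Continuous G := by fun_prop
  have hGtr : ∀ z k, G (tr z k) = G z := by
    intro z k
    simp only [G, F_tr hFdeg]
    simp only [tr]; push_cast; ring
  obtain ⟨C, hC⟩ : ∃ C, ∀ z ∈ pr ⁻¹' K, |G z| ≤ C := by
    obtain ⟨C, hC⟩ := (slab_compact hKc 0 1).exists_bound_of_continuousOn hG.continuousOn
    refine ⟨C, fun z hz => ?_⟩
    rw [← hGtr z (-⌊z.1⌋)]
    refine hC _ ⟨⟨?_, ?_⟩, ⟨pr z, hz, rfl⟩⟩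
    · have := Int.floor_le z.1
      simp only [tr]; push_cast; linarith
    · have := Int.lt_floor_add_one z.1
      simp only [tr]; push_cast; linarith
  have hbd : ∀ n : ℕ, ∀ z ∈ pr ⁻¹' K, ‖G (F^[n] z) / (d:ℝ) ^ (n + 1)‖ ≤ C * (|(d:ℝ)|⁻¹) ^ (n + 1) := by
    intro n z hz
    rw [Real.norm_eq_abs, abs_div, abs_pow, div_eq_mul_inv, inv_pow]
    exact mul_le_mul_of_nonneg_right (hC _ (hinvn n z hz)) (by positivity)
  have hsum : Summable fun n : ℕ => C * (|(d:ℝ)|⁻¹) ^ (n + 1) := by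
    apply Summable.mul_left
    exact (summable_nat_add_iff 1).2
      (summable_geometric_of_lt_one (by positivity) (inv_lt_one_of_one_lt₀ hd1))
  let H : AnnTil → ℝ := fun z => z.1 + ∑' n : ℕ, G (F^[n] z) / (d:ℝ) ^ (n + 1)
  have hcont : ContinuousOn H (pr ⁻¹' K) := by
    refine continuous_fst.continuousOn.add (continuousOn_tsum (fun n => ?_) hsum hbd)
    exact ((hG.comp (hFc.iterate n)).div_const _).continuousOn
  have hpart : ∀ z, ∀ m : ℕ, z.1 + ∑ n ∈ Finset.range m, G (F^[n] z) / (d:ℝ) ^ (n + 1)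
      = (F^[m] z).1 / (d:ℝ) ^ m := by
    intro z m
    induction m with
    | zero => simp
    | succ m ih =>
      rw [Finset.sum_range_succ, ← add_assoc, ih, Function.iterate_succ_apply']
      simp only [G]
      field_simp
      ring
  have hlim : ∀ z ∈ pr ⁻¹' K, Filter.Tendsto
        (fun n : ℕ => (F^[n] z).1 / (d : ℝ) ^ n) Filter.atTop (nhds (H z)) := by
    intro z hz
    have hs : Summable fun n : ℕ => G (F^[n] z) / (d:ℝ) ^ (n + 1) :=
      Summable.of_norm_bounded hsum fun n => hbd n z hz
    refine (hs.hasSum.tendsto_sum_nat.const_add z.1).congr fun m => hpart z m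
  have hiter : ∀ n : ℕ, ∀ z, F^[n] (tr z 1) = tr (F^[n] z) (d ^ n) := by
    intro n
    induction n with
    | zero => intro z; simp
    | succ n ih =>
      intro z
      rw [Function.iterate_succ_apply', ih, F_tr hFdeg, Function.iterate_succ_apply', pow_succ']
  have h1 : ∀ z ∈ pr ⁻¹' K, H (tr z 1) = H z + 1 := by
    intro z hz
    refine tendsto_nhds_unique (hlim _ (tr_mem hz 1)) (((hlim z hz).add_const 1).congr fun n => ?_)
    rw [hiter]
    simp only [tr]; push_cast
    field_simp
  have h2 : ∀ z ∈ pr ⁻¹' K, H (F z) = d * H z := by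
    intro z hz
    refine tendsto_nhds_unique (hlim _ (hinv z hz))
      ((((hlim z hz).comp (tendsto_add_atTop_nat 1)).const_mul (d:ℝ)).congr fun n => ?_)
    simp only [Function.comp, Function.iterate_succ_apply, pow_succ]
    field_simp
  have h3 : ∀ z ∈ pr ⁻¹' K, |H z - z.1| ≤ ∑' n : ℕ, C * (|(d:ℝ)|⁻¹) ^ (n + 1) := by
    intro z hz
    simp only [H, add_sub_cancel_left]
    exact tsum_of_norm_bounded hsum.hasSum fun n => hbd n z hz
  exact ⟨H, hcont, h1, h2, ⟨_, h3⟩, hlim, H_surj K hKc hKconn hKe H hcont h1 _ h3⟩
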